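/- Let μ ⊢ p be a Young diagram obtained by adding a cell x to λ ⊢ p-1. Then the product over addable cells a ≠ x of λ of (cont(x) - cont(a)), divided by the product over removable cells c of λ of (cont(x) - cont(c)), equals p · d_λ / d_μ, where d_ν is the number of standard Young tableaux of shape ν. -/

import Mathlib

/-- The number of standard Young tableaux of shape `μ`, encoded as the number of
saturated chains `⊥ = T 0 ⊆ T 1 ⊆ ⋯ ⊆ T |μ| = μ` in the Young lattice in which each
step adds exactly one cell. -/
noncomputable def sytCount (μ : YoungDiagram) : ℕ :=
  Nat.card {T : Fin (μ.card + 1) → YoungDiagram //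
    T 0 = ⊥ ∧ T (Fin.last μ.card) = μ ∧
    ∀ i : Fin μ.card, T i.castSucc ≤ T i.succ ∧
      (T i.succ).card = (T i.castSucc).card + 1}

/-- The number of semistandard Young tableaux of shape `μ` with entries in
`{0, 1, …, d-1}` (i.e. `d` allowed symbols). -/
noncomputable def ssytCount (μ : YoungDiagram) (d : ℕ) : ℕ :=
  Nat.card {T : SemistandardYoungTableau μ // ∀ i j : ℕ, (i, j) ∈ μ → T i j < d}

/-- A cell `c` is addable to `μ` if it is not in `μ` and adding it yields a valid
Young diagram. -/
def IsAddableCell (μ : YoungDiagram) (c : ℕ × ℕ) : Prop :=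
  c ∉ μ ∧ ∃ ν : YoungDiagram, ν.cells = insert c μ.cells

/-- A cell `c` is removable from `μ` if it is in `μ` and removing it yields a valid
Young diagram. -/
def IsRemovableCell (μ : YoungDiagram) (c : ℕ × ℕ) : Prop :=
  c ∈ μ ∧ ∃ ν : YoungDiagram, ν.cells = μ.cells.erase c

/-- The content `j - i` of a cell `(i, j)`, as a rational number. -/
def contQ (c : ℕ × ℕ) : ℚ := (c.2 : ℚ) - (c.1 : ℚ)

/-- The weight of `i` in the partial fraction expansion of `∏ j ∈ s, (1 - 1 / (z - l j))`. -/
noncomputable def partialWeight (s : Finset ℕ) (l : ℕ → ℚ) (i : ℕ) : ℚ :=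
  ∏ j ∈ s.erase i, (l i - 1 - l j) / (l i - l j)

lemma partialWeight_insert {s : Finset ℕ} {l : ℕ → ℚ} {m i : ℕ} (hm : m ∉ s) (hi : i ∈ s) :
    partialWeight (insert m s) l i = partialWeight s l i * ((l i - 1 - l m) / (l i - l m)) := by
  have hne : m ≠ i := fun h => hm (h ▸ hi)
  rw [partialWeight, partialWeight, Finset.erase_insert_of_ne hne,
    Finset.prod_insert (by simp [hm]), mul_comm]

lemma partialWeight_insert_self {s : Finset ℕ} {l : ℕ → ℚ} {m : ℕ} (hm : m ∉ s) :
    partialWeight (insert m s) l m = ∏ j ∈ s, (l m - 1 - l j) / (l m - l j) := by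
  rw [partialWeight, Finset.erase_insert hm]

lemma prod_eq_one_sub_sum_partialWeight (s : Finset ℕ) (l : ℕ → ℚ) (hl : Set.InjOn l s)
    (z : ℚ) (hz : ∀ i ∈ s, z ≠ l i) :
    ∏ j ∈ s, (z - 1 - l j) / (z - l j) = 1 - ∑ i ∈ s, partialWeight s l i / (z - l i) := by
  induction s using Finset.induction_on generalizing z with
  | empty => simp
  | insert m s hm ih =>
    have hl' : Set.InjOn l s := hl.mono (by simp)
    have hlm : ∀ i ∈ s, l m ≠ l i := fun i hi h =>
      hm (by rwa [hl (by simp) (by simp [hi]) h])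
    rw [Finset.prod_insert hm, Finset.sum_insert hm, partialWeight_insert_self hm,
      ih hl' z (fun i hi => hz i (by simp [hi])), ih hl' (l m) hlm]
    have hzm : z - l m ≠ 0 := sub_ne_zero.2 (hz m (by simp))
    have key : ∑ i ∈ s, partialWeight (insert m s) l i / (z - l i) =
        ∑ i ∈ s, partialWeight s l i / (z - l i) -
          (1 / (z - l m)) * (∑ i ∈ s, partialWeight s l i / (z - l i)
            - ∑ i ∈ s, partialWeight s l i / (l m - l i)) := by
      rw [← Finset.sum_sub_distrib, Finset.mul_sum, ← Finset.sum_sub_distrib]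
      refine Finset.sum_congr rfl fun i hi => ?_
      rw [partialWeight_insert hm hi]
      have h1 : z - l i ≠ 0 := sub_ne_zero.2 (hz i (by simp [hi]))
      have h2 : l i - l m ≠ 0 := sub_ne_zero.2 (hlm i hi).symm
      rw [← neg_sub (l i) (l m), div_neg]
      field_simp
      ring
    rw [key]
    field_simp
    ring

lemma sum_partialWeight (s : Finset ℕ) (l : ℕ → ℚ) (hl : Set.InjOn l s) :
    ∑ i ∈ s, partialWeight s l i = s.card ∧
      ∑ i ∈ s, l i * partialWeight s l i = ∑ i ∈ s, l i - s.card * (s.card - 1) / 2 := by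
  induction s using Finset.induction_on with
  | empty => simp
  | insert m s hm ih =>
    have hl' : Set.InjOn l s := hl.mono (by simp)
    have hlm : ∀ i ∈ s, l m ≠ l i := fun i hi h =>
      hm (by rwa [hl (by simp) (by simp [hi]) h])
    obtain ⟨ih1, ih2⟩ := ih hl'
    have e (i) (hi : i ∈ s) : partialWeight (insert m s) l i =
        partialWeight s l i + partialWeight s l i / (l m - l i) := by
      rw [partialWeight_insert hm hi]
      have h2 : l i - l m ≠ 0 := sub_ne_zero.2 (hlm i hi).symm
      rw [← neg_sub (l i) (l m), div_neg]
      field_simp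
      ring
    have e' (i) (hi : i ∈ s) : l i * partialWeight (insert m s) l i =
        l i * partialWeight s l i + l m * (partialWeight s l i / (l m - l i))
          - partialWeight s l i := by
      rw [e i hi]
      have h3 : l m - l i ≠ 0 := sub_ne_zero.2 (hlm i hi)
      field_simp
      ring
    rw [Finset.sum_insert hm, Finset.sum_insert hm, Finset.sum_insert hm,
      Finset.card_insert_of_notMem hm, Finset.sum_congr rfl e, Finset.sum_congr rfl e',
      partialWeight_insert_self hm, prod_eq_one_sub_sum_partialWeight s l hl' _ hlm,
      Finset.sum_sub_distrib, Finset.sum_add_distrib, Finset.sum_add_distrib, ih1, ih2,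
      ← Finset.mul_sum]
    push_cast
    constructor <;> ring

/-- The Vandermonde product `∏ j < i < n, (f j - f i)`. -/
def vandermondeProd (n : ℕ) (f : ℕ → ℚ) : ℚ :=
  ∏ i ∈ Finset.range n, ∏ j ∈ Finset.range i, (f j - f i)

lemma vandermondeProd_ne_zero {n : ℕ} {f : ℕ → ℚ} (hf : Set.InjOn f (Finset.range n)) :
    vandermondeProd n f ≠ 0 := by
  refine Finset.prod_ne_zero_iff.2 fun i hi => Finset.prod_ne_zero_iff.2 fun j hj h => ?_
  simp only [Finset.mem_range] at hi hj
  have := hf (by simp; omega) (by simpa using hi) (sub_eq_zero.1 h)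
  omega

lemma vandermondeProd_mul_prod_erase {n r : ℕ} {f g : ℕ → ℚ} (hr : r < n)
    (hfg : ∀ j, j ≠ r → f j = g j) :
    vandermondeProd n g * ∏ j ∈ (Finset.range n).erase r, (f r - f j) =
      vandermondeProd n f * ∏ j ∈ (Finset.range n).erase r, (g r - f j) := by
  induction n with
  | zero => omega
  | succ n ih =>
    rw [vandermondeProd, vandermondeProd, Finset.prod_range_succ, Finset.prod_range_succ,
      Finset.range_add_one]
    rcases Nat.lt_succ_iff_lt_or_eq.1 hr with h | rfl
    · rw [Finset.erase_insert_of_ne h.ne', Finset.prod_insert (by simp),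
        Finset.prod_insert (by simp),
        ← Finset.mul_prod_erase (Finset.range n) (fun j => f j - f n) (Finset.mem_range.2 h),
        ← Finset.mul_prod_erase (Finset.range n) (fun j => g j - g n) (Finset.mem_range.2 h),
        ← hfg n h.ne']
      have e : ∏ j ∈ (Finset.range n).erase r, (g j - f n) =
          ∏ j ∈ (Finset.range n).erase r, (f j - f n) :=
        Finset.prod_congr rfl fun j hj => by rw [hfg j (Finset.ne_of_mem_erase hj)]
      rw [e]
      have := ih h
      rw [vandermondeProd, vandermondeProd] at this
      linear_combination (f r - f n) * (g r - f n) *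
        (∏ j ∈ (Finset.range n).erase r, (f j - f n)) * this
    · rw [Finset.erase_insert (by simp)]
      have e1 : ∏ i ∈ Finset.range r, ∏ j ∈ Finset.range i, (g j - g i) =
          ∏ i ∈ Finset.range r, ∏ j ∈ Finset.range i, (f j - f i) :=
        Finset.prod_congr rfl fun i hi => Finset.prod_congr rfl fun j hj => by
          simp only [Finset.mem_range] at hi hj
          rw [hfg i (by omega), hfg j (by omega)]
      have e2 : (∏ j ∈ Finset.range r, (g j - g r)) * ∏ j ∈ Finset.range r, (f r - f j) =
          (∏ j ∈ Finset.range r, (f j - f r)) * ∏ j ∈ Finset.range r, (g r - f j) := by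
        rw [← Finset.prod_mul_distrib, ← Finset.prod_mul_distrib]
        refine Finset.prod_congr rfl fun j hj => ?_
        rw [hfg j (Finset.mem_range.1 hj).ne]
        ring
      rw [e1, mul_assoc, mul_assoc, e2]

namespace YoungDiagram

lemma eq_of_rowLen_eq {μ ν : YoungDiagram} (h : ∀ i, μ.rowLen i = ν.rowLen i) : μ = ν := by
  ext ⟨i, j⟩
  rw [mem_cells, mem_cells, mem_iff_lt_rowLen, mem_iff_lt_rowLen, h]

/-- `μ` is obtained from `ν` by adding one cell at the end of row `r`. -/
def CoversAt (ν μ : YoungDiagram) (r : ℕ) : Prop :=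
  ∀ j, μ.rowLen j = ν.rowLen j + if j = r then 1 else 0

lemma CoversAt.cells_eq {ν μ : YoungDiagram} {r : ℕ} (h : CoversAt ν μ r) :
    μ.cells = insert (r, ν.rowLen r) ν.cells := by
  ext ⟨i, j⟩
  have := h i
  rw [Finset.mem_insert, mem_cells, mem_cells, mem_iff_lt_rowLen, mem_iff_lt_rowLen, Prod.mk.injEq]
  split_ifs at this with hi
  · subst hi; omega
  · omega

lemma CoversAt.card_eq {ν μ : YoungDiagram} {r : ℕ} (h : CoversAt ν μ r) :
    μ.card = ν.card + 1 := by
  rw [YoungDiagram.card, h.cells_eq, Finset.card_insert_of_notMem]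
  rw [mem_cells, mem_iff_lt_rowLen]
  exact lt_irrefl _

lemma CoversAt.le {ν μ : YoungDiagram} {r : ℕ} (h : CoversAt ν μ r) : ν ≤ μ := by
  rw [← cells_subset_iff, h.cells_eq]
  exact Finset.subset_insert _ _

lemma CoversAt.left_unique {ν ν' μ : YoungDiagram} {r : ℕ} (h : CoversAt ν μ r)
    (h' : CoversAt ν' μ r) : ν = ν' :=
  eq_of_rowLen_eq fun i => by have := h i; have := h' i; omega

lemma CoversAt.row_unique {ν μ : YoungDiagram} {r r' : ℕ} (h : CoversAt ν μ r)
    (h' : CoversAt ν μ r') : r = r' := by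
  by_contra hne
  have h1 := h r
  have h2 := h' r
  rw [if_pos rfl] at h1
  rw [if_neg hne] at h2
  omega

lemma coversAt_of_cells_eq_insert {ν μ : YoungDiagram} {c : ℕ × ℕ} (hc : c ∉ ν)
    (h : μ.cells = insert c ν.cells) : c.2 = ν.rowLen c.1 ∧ CoversAt ν μ c.1 := by
  obtain ⟨a, b⟩ := c
  have key (i j : ℕ) : j < μ.rowLen i ↔ (i = a ∧ j = b) ∨ j < ν.rowLen i := by
    rw [← mem_iff_lt_rowLen, ← mem_iff_lt_rowLen, ← mem_cells, h, Finset.mem_insert, mem_cells,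
      Prod.mk.injEq]
  rw [mem_iff_lt_rowLen] at hc
  have hb : b = ν.rowLen a := by
    have h1 := key a b
    have h2 := key a (ν.rowLen a)
    omega
  refine ⟨hb, fun i => eq_of_forall_lt_iff fun j => ?_⟩
  rw [key]
  dsimp only
  split_ifs with hi
  · subst hi; omega
  · omega

lemma exists_coversAt {ν μ : YoungDiagram} (hle : ν ≤ μ) (hcard : μ.card = ν.card + 1) :
    ∃ r, CoversAt ν μ r := by
  obtain ⟨c, hc, h⟩ := Finset.exists_eq_insert_iff.2
    ⟨cells_subset_iff.2 hle, show ν.card + 1 = μ.card from hcard.symm⟩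
  exact ⟨c.1, (coversAt_of_cells_eq_insert (by simpa using hc) h.symm).2⟩

lemma exists_coversAt_left_iff {μ : YoungDiagram} {r : ℕ} :
    (∃ ν, CoversAt ν μ r) ↔ μ.rowLen (r + 1) < μ.rowLen r := by
  constructor
  · rintro ⟨ν, h⟩
    have h1 := h r
    have h2 := h (r + 1)
    have := ν.rowLen_anti r (r + 1) (by omega)
    rw [if_pos rfl] at h1
    rw [if_neg (by omega)] at h2
    omega
  · intro h
    let ν : YoungDiagram :=
      { cells := μ.cells.erase (r, μ.rowLen r - 1)
        isLowerSet := by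
          rintro ⟨i, j⟩ ⟨i', j'⟩ ⟨hi : i' ≤ i, hj : j' ≤ j⟩ hm
          simp only [Finset.coe_erase, Set.mem_sdiff, Finset.mem_coe, mem_cells,
            mem_iff_lt_rowLen, Set.mem_singleton_iff, Prod.mk.injEq] at hm ⊢
          have h1 := μ.rowLen_anti i' i hi
          refine ⟨by omega, ?_⟩
          rintro ⟨rfl, rfl⟩
          rcases hi.eq_or_lt with rfl | hlt
          · omega
          · have h2 := μ.rowLen_anti (i' + 1) i hlt
            omega }
    have hmem : (r, μ.rowLen r - 1) ∈ μ.cells := by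
      rw [mem_cells, mem_iff_lt_rowLen]; omega
    refine ⟨ν, (coversAt_of_cells_eq_insert (c := (r, μ.rowLen r - 1)) ?_ ?_).2⟩
    · rw [← mem_cells]; exact Finset.notMem_erase _ _
    · exact (Finset.insert_erase hmem).symm

lemma exists_coversAt_right_iff {ν : YoungDiagram} {r : ℕ} :
    (∃ μ, CoversAt ν μ r) ↔ (r = 0 ∨ ν.rowLen r < ν.rowLen (r - 1)) := by
  constructor
  · rintro ⟨μ, h⟩
    rcases r with _ | r
    · simp
    have h1 := h r
    have h2 := h (r + 1)
    have := μ.rowLen_anti r (r + 1) (by omega)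
    rw [if_neg (by omega)] at h1
    rw [if_pos rfl] at h2
    simp
    omega
  · intro h
    let μ : YoungDiagram :=
      { cells := insert (r, ν.rowLen r) ν.cells
        isLowerSet := by
          rintro ⟨i, j⟩ ⟨i', j'⟩ ⟨hi : i' ≤ i, hj : j' ≤ j⟩ hm
          simp only [Finset.coe_insert, Set.mem_insert_iff, Finset.mem_coe, mem_cells,
            mem_iff_lt_rowLen, Prod.mk.injEq] at hm ⊢
          have h1 := ν.rowLen_anti i' i hi
          rcases hm with ⟨rfl, rfl⟩ | hm
          · rcases hi.eq_or_lt with rfl | hlt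
            · omega
            · have h2 := ν.rowLen_anti i' (i - 1) (by omega)
              omega
          · omega }
    refine ⟨μ, (coversAt_of_cells_eq_insert (c := (r, ν.rowLen r)) ?_ rfl).2⟩
    rw [mem_iff_lt_rowLen]
    exact lt_irrefl _

lemma isAddableCell_iff {ν : YoungDiagram} {c : ℕ × ℕ} :
    IsAddableCell ν c ↔ c.2 = ν.rowLen c.1 ∧ (c.1 = 0 ∨ ν.rowLen c.1 < ν.rowLen (c.1 - 1)) := by
  rw [← exists_coversAt_right_iff]
  constructor
  · rintro ⟨hc, μ, h⟩
    exact ⟨(coversAt_of_cells_eq_insert hc h).1, μ, (coversAt_of_cells_eq_insert hc h).2⟩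
  · obtain ⟨a, b⟩ := c
    rintro ⟨hb, μ, h⟩
    dsimp only at hb h
    subst hb
    refine ⟨?_, μ, h.cells_eq⟩
    rw [mem_iff_lt_rowLen]
    exact lt_irrefl _

lemma isRemovableCell_iff {μ : YoungDiagram} {c : ℕ × ℕ} :
    IsRemovableCell μ c ↔ c.2 = μ.rowLen c.1 - 1 ∧ μ.rowLen (c.1 + 1) < μ.rowLen c.1 := by
  rw [← exists_coversAt_left_iff]
  constructor
  · rintro ⟨hc, ν, h⟩
    have := coversAt_of_cells_eq_insert (c := c) (ν := ν) (μ := μ)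
      (by rw [← mem_cells, h]; exact Finset.notMem_erase _ _)
      (by rw [h, Finset.insert_erase (by simpa using hc)])
    have h1 := this.2 c.1
    rw [if_pos rfl] at h1
    exact ⟨by omega, ν, this.2⟩
  · obtain ⟨a, b⟩ := c
    rintro ⟨hb, ν, h⟩
    dsimp only at hb h
    have h1 := h a
    rw [if_pos rfl] at h1
    obtain rfl : b = ν.rowLen a := by omega
    refine ⟨by rw [mem_iff_lt_rowLen]; omega, ν, ?_⟩
    rw [h.cells_eq, Finset.erase_insert]
    rw [mem_cells, mem_iff_lt_rowLen]
    exact lt_irrefl _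

lemma rowLen_eq_zero {μ : YoungDiagram} {i : ℕ} (h : μ.colLen 0 ≤ i) : μ.rowLen i = 0 := by
  by_contra h0
  have := mem_iff_lt_colLen.1 (mem_iff_lt_rowLen.2 (Nat.pos_of_ne_zero h0))
  omega

lemma card_eq_sum_rowLen {μ : YoungDiagram} {K : ℕ} (hK : ∀ i, K < i → μ.rowLen i = 0) :
    μ.card = ∑ i ∈ Finset.range (K + 1), μ.rowLen i := by
  rw [YoungDiagram.card, Finset.card_eq_sum_card_fiberwise (f := Prod.fst)
    (t := Finset.range (K + 1))]
  · exact Finset.sum_congr rfl fun i _ => (μ.rowLen_eq_card).symm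
  · rintro ⟨i, j⟩ hc
    have hc' : j < μ.rowLen i := by simpa [mem_iff_lt_rowLen] using hc
    simp only [Finset.coe_range, Set.mem_Iio]
    by_contra hi
    have := hK i (by omega)
    omega

/-- The diagram obtained from `μ` by deleting the last cell of row `r`, when this is possible. -/
noncomputable def eraseEnd (μ : YoungDiagram) (r : ℕ) : YoungDiagram :=
  open Classical in if h : ∃ ν, CoversAt ν μ r then h.choose else μ

lemma coversAt_eraseEnd {μ : YoungDiagram} {r : ℕ} (h : μ.rowLen (r + 1) < μ.rowLen r) :
    CoversAt (μ.eraseEnd r) μ r := by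
  have h' := exists_coversAt_left_iff.2 h
  rw [eraseEnd, dif_pos h']
  exact h'.choose_spec

/-- The rows among `0, …, K` whose last cell is removable. -/
def removableRows (K : ℕ) (μ : YoungDiagram) : Finset ℕ :=
  (Finset.range (K + 1)).filter fun i => μ.rowLen (i + 1) < μ.rowLen i

/-- Saturated chains of length `n` from `⊥` to `μ` in the Young lattice. -/
abbrev Chain (n : ℕ) (μ : YoungDiagram) : Type :=
  {T : Fin (n + 1) → YoungDiagram // T 0 = ⊥ ∧ T (Fin.last n) = μ ∧
    ∀ i : Fin n, T i.castSucc ≤ T i.succ ∧ (T i.succ).card = (T i.castSucc).card + 1}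

/-- Append a diagram covering the top of a chain. -/
def Chain.snoc {n : ℕ} {ν μ : YoungDiagram} {r : ℕ} (h : CoversAt ν μ r) (T : Chain n ν) :
    Chain (n + 1) μ :=
  ⟨Fin.snoc (α := fun _ => YoungDiagram) T.1 μ, by
    refine ⟨?_, by simp, fun i => ?_⟩
    · exact (Fin.snoc_castSucc (α := fun _ => YoungDiagram) μ T.1 0).trans T.2.1
    · induction i using Fin.lastCases with
      | last =>
        rw [Fin.snoc_castSucc, Fin.succ_last, Fin.snoc_last, T.2.2.1]
        exact ⟨h.le, h.card_eq⟩
      | cast i =>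
        rw [Fin.snoc_castSucc, Fin.succ_castSucc, Fin.snoc_castSucc]
        exact T.2.2.2 i⟩

lemma snoc_bijective {n K : ℕ} {μ : YoungDiagram} (hK : ∀ i, K < i → μ.rowLen i = 0) :
    Function.Bijective (fun x : Σ i : removableRows K μ, Chain n (μ.eraseEnd i) =>
      Chain.snoc (coversAt_eraseEnd (Finset.mem_filter.1 x.1.2).2) x.2) := by
  constructor
  · rintro ⟨⟨i, hi⟩, T⟩ ⟨⟨i', hi'⟩, T'⟩ h
    have h1 : T.1 = T'.1 := by
      have h0 : (Fin.snoc (α := fun _ => YoungDiagram) T.1 μ : Fin (n + 2) → YoungDiagram) =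
        Fin.snoc (α := fun _ => YoungDiagram) T'.1 μ := congrArg Subtype.val h
      exact (Fin.snoc_inj.1 h0).1
    have h2 : μ.eraseEnd i = μ.eraseEnd i' := by rw [← T.2.2.1, ← T'.2.2.1, h1]
    have c := coversAt_eraseEnd (Finset.mem_filter.1 hi).2
    have c' := coversAt_eraseEnd (Finset.mem_filter.1 hi').2
    rw [← h2] at c'
    obtain rfl := c.row_unique c'
    obtain rfl : T = T' := Subtype.ext h1
    rfl
  · rintro ⟨T, h0, hl, hs⟩
    have hlast := hs (Fin.last n)
    rw [Fin.succ_last, hl] at hlast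
    obtain ⟨r, hr⟩ := exists_coversAt hlast.1 hlast.2
    have hr' := exists_coversAt_left_iff.1 ⟨_, hr⟩
    have hmem : r ∈ removableRows K μ := by
      refine Finset.mem_filter.2 ⟨?_, hr'⟩
      by_contra hrK
      have := hK r (by simpa using hrK)
      omega
    refine ⟨⟨⟨r, hmem⟩, ⟨fun i => T i.castSucc, h0, ?_, fun i => ?_⟩⟩, ?_⟩
    · exact hr.left_unique (coversAt_eraseEnd hr')
    · have := hs i.castSucc
      rwa [Fin.succ_castSucc] at this
    · refine Subtype.ext ?_
      change Fin.snoc (α := fun _ => YoungDiagram) (fun i => T i.castSucc) μ = T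
      rw [← hl]
      exact Fin.snoc_init_self (α := fun _ => YoungDiagram) T

instance finite_chain (n : ℕ) (μ : YoungDiagram) : Finite (Chain n μ) := by
  induction n generalizing μ with
  | zero =>
    have : Subsingleton (Chain 0 μ) := ⟨fun T T' => Subtype.ext <| funext fun i => by
      rw [Fin.fin_one_eq_zero i, T.2.1, T'.2.1]⟩
    infer_instance
  | succ n ih =>
    exact Finite.of_surjective _
      (snoc_bijective (K := μ.colLen 0) fun i hi => rowLen_eq_zero hi.le).2

lemma card_chain_succ {n K : ℕ} {μ : YoungDiagram} (hK : ∀ i, K < i → μ.rowLen i = 0) :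
    Nat.card (Chain (n + 1) μ) = ∑ i ∈ removableRows K μ, Nat.card (Chain n (μ.eraseEnd i)) := by
  rw [← Nat.card_congr (Equiv.ofBijective _ (snoc_bijective hK)), Nat.card_sigma,
    Finset.sum_coe_sort _ fun i => Nat.card (Chain n (μ.eraseEnd i))]

lemma card_chain_zero : Nat.card (Chain 0 ⊥) = 1 := by
  rw [Nat.card_eq_one_iff_unique]
  refine ⟨⟨fun T T' => Subtype.ext <| funext fun i => ?_⟩,
    ⟨⟨fun _ => ⊥, rfl, rfl, fun i => i.elim0⟩⟩⟩
  rw [Fin.fin_one_eq_zero i, T.2.1, T'.2.1]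

/-- The shifted row lengths `μ_i + K - i`. -/
def shiftedRow (K : ℕ) (μ : YoungDiagram) (i : ℕ) : ℚ := μ.rowLen i + K - i

lemma shiftedRow_injective (K : ℕ) (μ : YoungDiagram) : Function.Injective (μ.shiftedRow K) := by
  have : StrictAnti (μ.shiftedRow K) := fun i j hij => by
    have h1 : (μ.rowLen j : ℚ) ≤ μ.rowLen i := by exact_mod_cast μ.rowLen_anti i j hij.le
    have h2 : (i : ℚ) < j := by exact_mod_cast hij
    rw [shiftedRow, shiftedRow]
    linarith
  exact this.injective

/-- Frobenius' expression for `sytCount μ / μ.card !`. -/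
noncomputable def frobenius (K : ℕ) (μ : YoungDiagram) : ℚ :=
  vandermondeProd (K + 1) (μ.shiftedRow K) /
    ∏ i ∈ Finset.range (K + 1), ((μ.rowLen i + (K - i)).factorial : ℚ)

lemma prod_factorial_ne_zero (K : ℕ) (μ : YoungDiagram) :
    ∏ i ∈ Finset.range (K + 1), ((μ.rowLen i + (K - i)).factorial : ℚ) ≠ 0 :=
  Finset.prod_ne_zero_iff.2 fun i _ => by exact_mod_cast Nat.factorial_ne_zero _

lemma frobenius_ne_zero (K : ℕ) (μ : YoungDiagram) : frobenius K μ ≠ 0 :=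
  div_ne_zero (vandermondeProd_ne_zero ((shiftedRow_injective K μ).injOn))
    (prod_factorial_ne_zero K μ)

lemma frobenius_bot (K : ℕ) : frobenius K ⊥ = 1 := by
  have h0 (i : ℕ) : (⊥ : YoungDiagram).rowLen i = 0 := by
    by_contra h
    exact notMem_bot _ (mem_iff_lt_rowLen.2 (Nat.pos_of_ne_zero h))
  rw [frobenius, div_eq_one_iff_eq (prod_factorial_ne_zero K ⊥), vandermondeProd,
    ← Finset.prod_range_reflect (fun i => (((⊥ : YoungDiagram).rowLen i + (K - i)).factorial : ℚ))]
  refine Finset.prod_congr rfl fun i hi => ?_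
  rw [Finset.mem_range] at hi
  rw [h0, show 0 + (K - (K + 1 - 1 - i)) = i by omega, ← Finset.prod_range_add_one_eq_factorial,
    ← Finset.prod_range_reflect]
  push_cast
  refine Finset.prod_congr rfl fun j hj => ?_
  rw [Finset.mem_range] at hj
  rw [shiftedRow, shiftedRow, h0, h0, Nat.cast_sub (by omega), Nat.cast_sub (by omega)]
  push_cast
  ring

lemma CoversAt.frobenius_eq {ν μ : YoungDiagram} {r K : ℕ} (h : CoversAt ν μ r) (hr : r ≤ K) :
    frobenius K ν = frobenius K μ *
      (μ.shiftedRow K r * partialWeight (Finset.range (K + 1)) (μ.shiftedRow K) r) := by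
  have hrmem : r ∈ Finset.range (K + 1) := Finset.mem_range.2 (by omega)
  have hrr := h r
  rw [if_pos rfl] at hrr
  have hne : ∀ j, j ≠ r → μ.rowLen j = ν.rowLen j := fun j hj => by
    rw [h j, if_neg hj, add_zero]
  have hl : ν.shiftedRow K r = μ.shiftedRow K r - 1 := by
    rw [shiftedRow, shiftedRow, hrr]; push_cast; ring
  have hv := vandermondeProd_mul_prod_erase (n := K + 1) (r := r) (f := μ.shiftedRow K)
    (g := ν.shiftedRow K) (by omega) fun j hj => by rw [shiftedRow, shiftedRow, hne j hj]
  have hfac : ∏ i ∈ Finset.range (K + 1), ((μ.rowLen i + (K - i)).factorial : ℚ) =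
      μ.shiftedRow K r * ∏ i ∈ Finset.range (K + 1), ((ν.rowLen i + (K - i)).factorial : ℚ) := by
    rw [← Finset.mul_prod_erase _ _ hrmem, ← Finset.mul_prod_erase (Finset.range (K + 1))
      (fun i => ((ν.rowLen i + (K - i)).factorial : ℚ)) hrmem, ← mul_assoc]
    congr 1
    · rw [hrr, show ν.rowLen r + 1 + (K - r) = ν.rowLen r + (K - r) + 1 by omega,
        Nat.factorial_succ, shiftedRow, hrr]
      push_cast [Nat.cast_sub hr]
      ring
    · exact Finset.prod_congr rfl fun j hj => by rw [hne j (Finset.ne_of_mem_erase hj)]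
  have hd : ∏ j ∈ (Finset.range (K + 1)).erase r, (μ.shiftedRow K r - μ.shiftedRow K j) ≠ 0 :=
    Finset.prod_ne_zero_iff.2 fun j hj => sub_ne_zero.2 fun he =>
      Finset.ne_of_mem_erase hj (shiftedRow_injective K μ he).symm
  have hμ := prod_factorial_ne_zero K μ
  have hν := prod_factorial_ne_zero K ν
  rw [hl] at hv
  rw [hfac] at hμ
  have hs := left_ne_zero_of_mul hμ
  rw [frobenius, frobenius, partialWeight, Finset.prod_div_distrib, hfac]
  field_simp
  linear_combination hv

lemma partialWeight_shiftedRow_eq_zero {μ : YoungDiagram} {i K : ℕ} (hi : i < K)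
    (h : ¬ μ.rowLen (i + 1) < μ.rowLen i) :
    partialWeight (Finset.range (K + 1)) (μ.shiftedRow K) i = 0 := by
  refine Finset.prod_eq_zero (i := i + 1) (by simp; omega) ?_
  have : μ.rowLen (i + 1) = μ.rowLen i := le_antisymm (μ.rowLen_anti _ _ (by omega)) (by omega)
  rw [shiftedRow, shiftedRow, this]
  push_cast
  ring

lemma sum_shiftedRow {μ : YoungDiagram} {K : ℕ} (hK : ∀ i, K < i → μ.rowLen i = 0) :
    ∑ i ∈ Finset.range (K + 1), μ.shiftedRow K i = μ.card + (K + 1) * K / 2 := by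
  have hid (n : ℕ) : ∑ i ∈ Finset.range (n + 1), (i : ℚ) = (n + 1) * n / 2 := by
    induction n with
    | zero => simp
    | succ n ih => rw [Finset.sum_range_succ, ih]; push_cast; ring
  simp only [shiftedRow]
  rw [Finset.sum_sub_distrib, Finset.sum_add_distrib, hid, card_eq_sum_rowLen hK]
  simp
  ring

theorem card_chain_eq_factorial_mul_frobenius {n K : ℕ} {μ : YoungDiagram} (hn : μ.card = n)
    (hK : ∀ i, K < i → μ.rowLen i = 0) :
    (Nat.card (Chain n μ) : ℚ) = n.factorial * frobenius K μ := by
  induction n generalizing μ with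
  | zero =>
    obtain rfl : μ = ⊥ := YoungDiagram.ext (Finset.card_eq_zero.1 hn)
    simp [card_chain_zero, frobenius_bot]
  | succ n ih =>
    have hterm : ∀ i ∈ removableRows K μ, (Nat.card (Chain n (μ.eraseEnd i)) : ℚ) =
        n.factorial * frobenius K μ * (μ.shiftedRow K i *
          partialWeight (Finset.range (K + 1)) (μ.shiftedRow K) i) := fun i hi => by
      obtain ⟨hi1, hi2⟩ := Finset.mem_filter.1 hi
      have c := coversAt_eraseEnd hi2
      rw [ih (by have := c.card_eq; omega) fun j hj => by have := c j; have := hK j hj; omega,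
        c.frobenius_eq (Nat.lt_succ_iff.1 (Finset.mem_range.1 hi1)), mul_assoc]
    rw [card_chain_succ hK, Nat.cast_sum, Finset.sum_congr rfl hterm, ← Finset.mul_sum,
      removableRows, Finset.sum_filter_of_ne, (sum_partialWeight _ _
        (shiftedRow_injective K μ).injOn).2, sum_shiftedRow hK, hn, Nat.factorial_succ]
    · simp
      ring
    · intro i hi hne
      by_contra h
      rcases (Nat.lt_succ_iff.1 (Finset.mem_range.1 hi)).lt_or_eq with hlt | rfl
      · exact hne (by rw [partialWeight_shiftedRow_eq_zero hlt h, mul_zero])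
      · rw [hK (i + 1) (by omega)] at h
        refine hne ?_
        rw [shiftedRow, show μ.rowLen i = 0 by omega]
        simp

end YoungDiagram

namespace YoungDiagram

lemma finprod_addable {lam : YoungDiagram} {K : ℕ} (hK : ∀ i, K ≤ i → lam.rowLen i = 0)
    {r : ℕ} (F : ℕ × ℕ → ℚ) :
    ∏ᶠ a ∈ {a | IsAddableCell lam a} \ {(r, lam.rowLen r)}, F a =
      (∏ j ∈ Finset.range K, if lam.rowLen (j + 1) < lam.rowLen j then
        (if j + 1 = r then 1 else F (j + 1, lam.rowLen (j + 1))) else 1) *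
      (if 0 = r then 1 else F (0, lam.rowLen 0)) := by
  have hset : {a | IsAddableCell lam a} \ {(r, lam.rowLen r)} =
      ((((Finset.range (K + 1)).filter
        fun j => j = 0 ∨ lam.rowLen j < lam.rowLen (j - 1)).erase r).image
          fun j => (j, lam.rowLen j) : Finset (ℕ × ℕ)) := by
    ext ⟨i, j⟩
    simp only [Set.mem_sdiff, Set.mem_ofPred_eq, isAddableCell_iff, Set.mem_singleton_iff,
      Finset.coe_image, Set.mem_image, Finset.mem_coe, Finset.mem_erase, Finset.mem_filter,
      Finset.mem_range, Prod.mk.injEq]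
    constructor
    · rintro ⟨⟨rfl, h⟩, hr⟩
      refine ⟨i, ⟨fun hir => hr ⟨hir, by rw [hir]⟩, ?_, h⟩, rfl, rfl⟩
      by_contra hi
      have := hK (i - 1) (by omega)
      omega
    · rintro ⟨i, ⟨hir, -, h⟩, rfl, rfl⟩
      exact ⟨⟨rfl, h⟩, fun hr => hir hr.1⟩
  rw [hset, finprod_mem_coe_finset, Finset.prod_image fun i _ j _ h => congrArg Prod.fst h]
  have hφ : ∀ j ∈ ((Finset.range (K + 1)).filter
        fun j => j = 0 ∨ lam.rowLen j < lam.rowLen (j - 1)).erase r, F (j, lam.rowLen j) =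
      if j = r then 1 else F (j, lam.rowLen j) := fun j hj => by
    rw [if_neg (Finset.ne_of_mem_erase hj)]
  rw [Finset.prod_congr rfl hφ, Finset.prod_erase
    (f := fun j => if j = r then 1 else F (j, lam.rowLen j)) _ (if_pos rfl), Finset.prod_filter,
    Finset.prod_range_succ']
  simp

lemma finprod_removable {lam : YoungDiagram} {K : ℕ} (hK : ∀ i, K ≤ i → lam.rowLen i = 0)
    (F : ℕ × ℕ → ℚ) :
    ∏ᶠ c ∈ {c | IsRemovableCell lam c}, F c =
      ∏ j ∈ Finset.range K, if lam.rowLen (j + 1) < lam.rowLen j then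
        F (j, lam.rowLen j - 1) else 1 := by
  have hset : {c | IsRemovableCell lam c} =
      (((Finset.range K).filter fun j => lam.rowLen (j + 1) < lam.rowLen j).image
          fun j => (j, lam.rowLen j - 1) : Finset (ℕ × ℕ)) := by
    ext ⟨i, j⟩
    simp only [Set.mem_ofPred_eq, isRemovableCell_iff, Finset.coe_image, Set.mem_image,
      Finset.mem_coe, Finset.mem_filter, Finset.mem_range, Prod.mk.injEq]
    constructor
    · rintro ⟨rfl, h⟩
      refine ⟨i, ⟨?_, h⟩, rfl, rfl⟩
      by_contra hi
      have := hK i (by omega)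
      omega
    · rintro ⟨i, ⟨-, h⟩, rfl, rfl⟩
      exact ⟨rfl, h⟩
  rw [hset, finprod_mem_coe_finset, Finset.prod_image fun i _ j _ h => congrArg Prod.fst h,
    Finset.prod_filter]

lemma CoversAt.content_quotient_eq {lam μ : YoungDiagram} {r K : ℕ} (h : CoversAt lam μ r)
    (hK : ∀ i, K ≤ i → μ.rowLen i = 0) :
    (∏ᶠ a ∈ {a | IsAddableCell lam a} \ {(r, lam.rowLen r)},
        (contQ (r, lam.rowLen r) - contQ a)) /
      (∏ᶠ c ∈ {c | IsRemovableCell lam c}, (contQ (r, lam.rowLen r) - contQ c)) =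
    μ.shiftedRow K r * partialWeight (Finset.range (K + 1)) (μ.shiftedRow K) r := by
  have hKl : ∀ i, K ≤ i → lam.rowLen i = 0 := fun i hi => by
    have := h i; have := hK i hi; omega
  have hrr := h r
  rw [if_pos rfl] at hrr
  have hrK : r < K := by
    by_contra hr
    have := hK r (by omega)
    omega
  have hl (j : ℕ) : μ.shiftedRow K j = lam.rowLen j + (if j = r then 1 else 0) + K - j := by
    rw [shiftedRow, h j]; push_cast; rfl
  set φ : ℕ → ℚ := fun j =>
    if j = r then 1 else contQ (r, lam.rowLen r) - contQ (j, lam.rowLen j) with hφ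
  set ψ : ℕ → ℚ := fun j => contQ (r, lam.rowLen r) - (lam.rowLen j - 1 - j) with hψ
  have hφ0 (j : ℕ) (hj : j ≠ r) : contQ (r, lam.rowLen r) - contQ (j, lam.rowLen j) ≠ 0 := by
    intro h0
    refine hj (shiftedRow_injective K lam ?_).symm
    simp only [contQ] at h0
    simp only [shiftedRow]
    linarith
  have hψr : ψ r = 1 := by simp [hψ, contQ]
  have hψK : ψ K = μ.shiftedRow K r := by
    rw [hl, if_pos rfl]
    simp only [hψ, contQ, hKl K le_rfl]
    push_cast
    ring
  have hψK0 : ψ K ≠ 0 := by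
    have h1 : (r : ℚ) < K := by exact_mod_cast hrK
    have h2 : (0 : ℚ) ≤ lam.rowLen r := by positivity
    rw [hψK, hl, if_pos rfl]
    linarith
  have hpw : partialWeight (Finset.range (K + 1)) (μ.shiftedRow K) r =
      (∏ j ∈ Finset.range (K + 1), φ j) / ∏ j ∈ Finset.range (K + 1), ψ j := by
    rw [partialWeight, ← Finset.prod_erase (Finset.range (K + 1)) (f := φ) (a := r) (by simp [hφ]),
      ← Finset.prod_erase (Finset.range (K + 1)) (f := ψ) hψr, ← Finset.prod_div_distrib]
    refine Finset.prod_congr rfl fun j hj => ?_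
    have hjr := Finset.ne_of_mem_erase hj
    rw [hl, hl, if_pos rfl, if_neg hjr]
    simp only [hφ, hψ, if_neg hjr, contQ]
    congr 1 <;> ring
  have hstep : ∀ j ∈ Finset.range K,
      (if lam.rowLen (j + 1) < lam.rowLen j then φ (j + 1) else 1) /
        (if lam.rowLen (j + 1) < lam.rowLen j then
          contQ (r, lam.rowLen r) - contQ (j, lam.rowLen j - 1) else 1) = φ (j + 1) / ψ j := by
    intro j _
    split_ifs with hj
    · congr 1
      simp only [hψ, contQ]
      rw [Nat.cast_sub (by omega)]
      push_cast
      ring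
    · have hjr : j + 1 ≠ r := by
        rintro rfl
        have := exists_coversAt_right_iff.1 ⟨μ, h⟩
        simp at this
        omega
      have he : lam.rowLen (j + 1) = lam.rowLen j :=
        le_antisymm (lam.rowLen_anti _ _ (by omega)) (by omega)
      have hφψ : φ (j + 1) = ψ j := by
        simp only [hφ, hψ, if_neg hjr, contQ, he]
        push_cast
        ring
      rw [← hφψ, div_one, div_self]
      simp only [hφ, if_neg hjr]
      exact hφ0 _ hjr
  rw [finprod_addable hKl, finprod_removable hKl, hpw, ← hψK, Finset.prod_range_succ ψ,
    Finset.prod_range_succ' φ, mul_div_right_comm, ← Finset.prod_div_distrib,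
    Finset.prod_congr rfl hstep, Finset.prod_div_distrib, ← mul_div_assoc,
    mul_comm (ψ K), mul_div_mul_right _ _ hψK0, mul_div_right_comm]

end YoungDiagram

/-- Kosuda's identity: for `μ ⊢ p` obtained from `λ ⊢ p - 1` by adding the cell `x`,
`∏_{a ∈ AC(λ) \ {x}} (cont x - cont a) / ∏_{c ∈ RC(λ)} (cont x - cont c)
  = p · d_λ / d_μ`. -/
theorem kosuda_identity (p : ℕ) (hp : 1 ≤ p) (lam μ : YoungDiagram) (x : ℕ × ℕ)
    (hlam : lam.card = p - 1) (hx : IsAddableCell lam x)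
    (hμ : μ.cells = insert x lam.cells) :
    (∏ᶠ a ∈ {a | IsAddableCell lam a} \ {x}, (contQ x - contQ a)) /
        (∏ᶠ c ∈ {c | IsRemovableCell lam c}, (contQ x - contQ c)) =
      (p : ℚ) * (sytCount lam : ℚ) / (sytCount μ : ℚ) := by
  have hp' : μ.card = p := by
    rw [YoungDiagram.card, hμ, Finset.card_insert_of_notMem (by simpa using hx.1)]
    change lam.card + 1 = p
    omega
  obtain ⟨a, b⟩ := x
  obtain ⟨hb, h⟩ := YoungDiagram.coversAt_of_cells_eq_insert hx.1 hμ
  dsimp only at hb h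
  subst hb
  have hK : ∀ i, μ.colLen 0 ≤ i → μ.rowLen i = 0 := fun i hi => YoungDiagram.rowLen_eq_zero hi
  have haK : a ≤ μ.colLen 0 := by
    by_contra ha
    have h1 := hK a (by omega)
    have h2 := h a
    rw [if_pos rfl] at h2
    omega
  have hdl : (sytCount lam : ℚ) = _ :=
    YoungDiagram.card_chain_eq_factorial_mul_frobenius (K := μ.colLen 0) rfl
      fun i hi => by have := h i; have := hK i hi.le; omega
  have hdμ : (sytCount μ : ℚ) = _ :=
    YoungDiagram.card_chain_eq_factorial_mul_frobenius (K := μ.colLen 0) rfl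
      fun i hi => hK i hi.le
  have hF := YoungDiagram.frobenius_ne_zero (μ.colLen 0) μ
  have hfac : ((p - 1).factorial : ℚ) ≠ 0 := by exact_mod_cast Nat.factorial_ne_zero _
  have hp0 : (p : ℚ) ≠ 0 := by exact_mod_cast (by omega : p ≠ 0)
  rw [h.content_quotient_eq hK, hdl, hdμ, hlam, hp', h.frobenius_eq haK,
    ← Nat.mul_factorial_pred (by omega : p ≠ 0)]
  push_cast
  field_simp
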